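/- arXiv:1905.04239 — 2 statements merged into one kernel-verified Lean document; each statement's English description precedes it below -/
import Mathlib

section
/- For all integers m ≥ 1 and n with m + 6 ≤ n − 1, writing p_m = P_n^{(m)}(1,0,0) for the finite left absorption probabilities of the three-state Grover walk (with n fixed), one has the sixth-order linear recurrence p_{m+6} − 134·p_{m+5} + 3599·p_{m+4} − 6932·p_{m+3} + 3599·p_{m+2} − 134·p_{m+1} + p_m = 0. -/
open scoped Classical
open Filter Topology

/-- Step value of a three-state internal state: `0` = R ↦ +1, `1` = S ↦ 0, `2` = L ↦ −1. -/
def gstep (σ : Fin 3) : ℤ := 1 - (σ : ℤ)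

/-- Step amplitudes of the three-state Grover walk: `A(σ→σ) = −1/3`, `A(σ→σ') = 2/3` for σ ≠ σ'. -/
noncomputable def gamp (σ σ' : Fin 3) : ℝ := if σ = σ' then -1/3 else 2/3

/-- Amplitude `A(γ) = Π_{k=1}^t A(σ_{k−1}→σ_k)` of a `t`-path `γ = (σ_0, …, σ_t)`. -/
noncomputable def gpamp {t : ℕ} (γ : Fin (t + 1) → Fin 3) : ℝ :=
  ∏ k : Fin t, gamp (γ k.castSucc) (γ k.succ)

/-- Partial displacement `S_k(γ) = σ_1 + ⋯ + σ_k` of a `t`-path `γ = (σ_0, …, σ_t)`. -/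
def gS {t : ℕ} (γ : Fin (t + 1) → Fin 3) (k : ℕ) : ℤ :=
  ∑ i ∈ Finset.univ.filter (fun i : Fin t => (i : ℕ) < k), gstep (γ i.succ)

/-- `c_t` for the semi-infinite walk: sum of `A(γ)` over `t`-paths with `σ_0 = R`, `σ_t = L`,
`S_t(γ) = −m`, and `S_k(γ) > −m` for all `k < t`. -/
noncomputable def gcInf (m : ℕ) (t : ℕ) : ℝ :=
  ∑ γ ∈ Finset.univ.filter (fun γ : Fin (t + 1) → Fin 3 =>
      γ 0 = 0 ∧ γ (Fin.last t) = 2 ∧ gS γ t = -(m : ℤ) ∧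
      ∀ k < t, -(m : ℤ) < gS γ k),
    gpamp γ

/-- `c_t` for the finite walk: sum of `A(γ)` over `t`-paths with `σ_0 = R`, `σ_t = L`,
`S_t(γ) = −m`, and `−m < S_k(γ) < n − m` for all `k < t`. -/
noncomputable def gcFin (n m : ℕ) (t : ℕ) : ℝ :=
  ∑ γ ∈ Finset.univ.filter (fun γ : Fin (t + 1) → Fin 3 =>
      γ 0 = 0 ∧ γ (Fin.last t) = 2 ∧ gS γ t = -(m : ℤ) ∧
      ∀ k < t, -(m : ℤ) < gS γ k ∧ gS γ k < (n : ℤ) - (m : ℤ)),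
    gpamp γ

/-- Semi-infinite left absorption probability `P_∞^{(m)}(1,0,0)` of the Grover walk. -/
noncomputable def GPinf (m : ℕ) : ℝ := ∑' t : ℕ, (gcInf m t) ^ 2

/-- Finite left absorption probability `P_n^{(m)}(1,0,0)` of the Grover walk. -/
noncomputable def GPfin (n m : ℕ) : ℝ := ∑' t : ℕ, (gcFin n m t) ^ 2

lemma gS_cons_succ {t : ℕ} (σ : Fin 3) (γ : Fin (t + 1) → Fin 3) (k : ℕ) :
    gS (Fin.cons σ γ : Fin (t + 1 + 1) → Fin 3) (k + 1) = gstep (γ 0) + gS γ k := by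
  simp [gS, Finset.sum_filter, Fin.sum_univ_succ]

lemma gS_zero {t : ℕ} (γ : Fin (t + 1) → Fin 3) : gS γ 0 = 0 := by
  simp [gS]

lemma gpamp_cons {t : ℕ} (σ : Fin 3) (γ : Fin (t + 1) → Fin 3) :
    gpamp (Fin.cons σ γ : Fin (t + 1 + 1) → Fin 3) = gamp σ (γ 0) * gpamp γ := by
  simp [gpamp, Fin.prod_univ_succ (n := t), Fin.castSucc_zero]

/-- Amplitude of being absorbed at `0` in exactly `t` steps, starting from position `x` with
internal state `σ`, for the walk on `0, …, n` with both end points absorbing. -/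
noncomputable def absorbAmp (n : ℤ) : ℕ → ℤ → Fin 3 → ℝ
  | 0, x, σ => if x = 0 ∧ σ = 2 then 1 else 0
  | t + 1, x, σ =>
    if 0 < x ∧ x < n then ∑ σ', gamp σ σ' * absorbAmp n t (x + gstep σ') σ' else 0

lemma sum_gpamp_eq_absorbAmp (n : ℤ) (t : ℕ) (x : ℤ) (σ : Fin 3) :
    (∑ γ ∈ Finset.univ.filter (fun γ : Fin (t + 1) → Fin 3 =>
      γ 0 = σ ∧ γ (Fin.last t) = 2 ∧ x + gS γ t = 0 ∧
      ∀ k < t, 0 < x + gS γ k ∧ x + gS γ k < n), gpamp γ) = absorbAmp n t x σ := by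
  induction t generalizing x σ with
  | zero =>
    rw [Finset.sum_filter, Fintype.sum_equiv (Equiv.funUnique (Fin 1) (Fin 3)) _
      (fun τ => if τ = σ ∧ τ = 2 ∧ x = 0 then (1 : ℝ) else 0)]
    · simp only [absorbAmp]
      by_cases h : σ = 2 <;> by_cases hx : x = 0 <;> simp [h, hx]
    · intro γ
      simp [gS, gpamp]
  | succ t ih =>
    simp only [absorbAmp, ← ih]
    have key : ∀ γ : Fin (t + 1) → Fin 3,
        ((∀ k < t + 1, 0 < x + gS (Fin.cons σ γ : Fin (t + 1 + 1) → Fin 3) k ∧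
          x + gS (Fin.cons σ γ : Fin (t + 1 + 1) → Fin 3) k < n) ↔
        (0 < x ∧ x < n) ∧ ∀ k < t, 0 < x + gstep (γ 0) + gS γ k ∧
          x + gstep (γ 0) + gS γ k < n) := by
      intro γ
      rw [Nat.forall_lt_succ_left]
      simp only [gS_cons_succ, gS_zero, add_zero, add_assoc]
    rw [Finset.sum_filter, ← (Fin.consEquiv (fun _ => Fin 3)).sum_comp, Fintype.sum_prod_type,
      Finset.sum_eq_single σ]
    · simp only [Fin.consEquiv, Equiv.coe_fn_mk, Fin.cons_zero, key, gS_cons_succ, gpamp_cons,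
        ← Fin.succ_last, Fin.cons_succ, true_and]
      split_ifs with hx
      · simp only [Finset.sum_filter, Finset.mul_sum, hx]
        rw [Finset.sum_comm]
        refine Finset.sum_congr rfl fun γ _ => ?_
        rw [Finset.sum_eq_single (γ 0)]
        · simp [add_assoc]
        · intro b _ hb
          simp [hb.symm]
        · simp
      · simp [hx]
    · intro b _ hb
      simp [Fin.consEquiv, hb]
    · simp

lemma gcFin_eq_absorbAmp (n m t : ℕ) : gcFin n m t = absorbAmp n t m 0 := by
  rw [← sum_gpamp_eq_absorbAmp, gcFin]
  refine Finset.sum_congr (Finset.filter_congr fun γ _ => ?_) fun _ _ => rfl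
  refine and_congr_right fun _ => and_congr_right fun _ => and_congr ?_ ?_
  · constructor <;> intro h <;> linarith
  · refine forall₂_congr fun k _ => and_congr ?_ ?_ <;> constructor <;> intro h <;> linarith

lemma gstep_mem (σ : Fin 3) : -1 ≤ gstep σ ∧ gstep σ ≤ 1 := by
  fin_cases σ <;> simp [gstep]

lemma absorbAmp_eq_zero_of_lt (n : ℤ) (t : ℕ) (x : ℤ) (σ : Fin 3) (h : (t : ℤ) < x) :
    absorbAmp n t x σ = 0 := by
  induction t generalizing x σ with
  | zero => simp only [absorbAmp]; rw [if_neg]; rintro ⟨rfl, -⟩; simp at h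
  | succ t ih =>
    simp only [absorbAmp]
    split_ifs
    · refine Finset.sum_eq_zero fun σ' _ => ?_
      have := gstep_mem σ'
      rw [ih, mul_zero]
      push_cast at h
      linarith
    · rfl

lemma sum_Icc_shift_interior (n s : ℤ) (hs : -1 ≤ s ∧ s ≤ 1) (h : ℤ → ℝ) :
    ∑ y ∈ Finset.Icc 0 n, (if 0 < y - s ∧ y - s < n then h (y - s) else 0) =
      ∑ x ∈ Finset.Icc 0 n, (if 0 < x ∧ x < n then h x else 0) := by
  rw [← Finset.sum_filter, ← Finset.sum_filter]
  refine Finset.sum_nbij' (fun y => y - s) (fun x => x + s) ?_ ?_ ?_ ?_ fun _ _ => rfl <;>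
    simp only [Finset.mem_filter, Finset.mem_Icc] <;> intros <;> omega

/-- One forward step of the walk, with the amplitude at the two end points discarded. -/
noncomputable def forwardStep (n : ℤ) (v : ℤ → Fin 3 → ℝ) (y : ℤ) (σ' : Fin 3) : ℝ :=
  if 0 < y - gstep σ' ∧ y - gstep σ' < n then ∑ σ, v (y - gstep σ') σ * gamp σ σ' else 0

lemma sum_sq_grover (u : Fin 3 → ℝ) :
    ∑ σ', (∑ σ, u σ * gamp σ σ') ^ 2 = ∑ σ, u σ ^ 2 := by
  simp [Fin.sum_univ_three, gamp]
  ring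

lemma sum_sq_forwardStep (n : ℤ) (v : ℤ → Fin 3 → ℝ) :
    ∑ y ∈ Finset.Icc 0 n, ∑ σ, forwardStep n v y σ ^ 2 =
      ∑ x ∈ Finset.Icc 0 n, if 0 < x ∧ x < n then ∑ σ, v x σ ^ 2 else 0 := by
  rw [Finset.sum_comm]
  have : ∀ σ' : Fin 3, ∑ y ∈ Finset.Icc 0 n, forwardStep n v y σ' ^ 2 =
      ∑ x ∈ Finset.Icc 0 n, if 0 < x ∧ x < n then (∑ σ, v x σ * gamp σ σ') ^ 2 else 0 := by
    intro σ'
    rw [← sum_Icc_shift_interior n (gstep σ') (gstep_mem σ')]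
    refine Finset.sum_congr rfl fun y _ => ?_
    simp only [forwardStep]
    split_ifs <;> simp
  simp only [this]
  rw [Finset.sum_comm]
  refine Finset.sum_congr rfl fun x _ => ?_
  split_ifs
  · exact sum_sq_grover _
  · simp

lemma sum_mul_absorbAmp_succ (n : ℤ) (t : ℕ) (v : ℤ → Fin 3 → ℝ) :
    ∑ x ∈ Finset.Icc 0 n, ∑ σ, v x σ * absorbAmp n (t + 1) x σ =
      ∑ y ∈ Finset.Icc 0 n, ∑ σ', forwardStep n v y σ' * absorbAmp n t y σ' := by
  rw [Finset.sum_comm (t := (Finset.univ : Finset (Fin 3))) (s := Finset.Icc 0 n)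
    (f := fun y σ' => forwardStep n v y σ' * absorbAmp n t y σ')]
  have : ∀ σ' : Fin 3, ∑ y ∈ Finset.Icc 0 n, forwardStep n v y σ' * absorbAmp n t y σ' =
      ∑ x ∈ Finset.Icc 0 n, if 0 < x ∧ x < n then
        (∑ σ, v x σ * gamp σ σ') * absorbAmp n t (x + gstep σ') σ' else 0 := by
    intro σ'
    rw [← sum_Icc_shift_interior n (gstep σ') (gstep_mem σ')]
    refine Finset.sum_congr rfl fun y _ => ?_
    simp only [forwardStep]
    split_ifs <;> simp
  simp only [this]
  rw [Finset.sum_comm (s := (Finset.univ : Finset (Fin 3)))]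
  refine Finset.sum_congr rfl fun x _ => ?_
  simp only [absorbAmp]
  split_ifs
  · simp only [Finset.mul_sum, Finset.sum_mul]
    rw [Finset.sum_comm]
    simp only [mul_assoc]
  · simp

lemma sum_sq_inner_absorbAmp_le (n : ℤ) (hn : 0 ≤ n) (K : ℕ) (v : ℤ → Fin 3 → ℝ) :
    ∑ t ∈ Finset.range K, (∑ x ∈ Finset.Icc 0 n, ∑ σ, v x σ * absorbAmp n t x σ) ^ 2 ≤
      ∑ x ∈ Finset.Icc 0 n, ∑ σ, v x σ ^ 2 := by
  induction K generalizing v with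
  | zero => simp only [Finset.range_zero, Finset.sum_empty]; positivity
  | succ K ih =>
    rw [Finset.sum_range_succ']
    simp only [sum_mul_absorbAmp_succ]
    have h0 : ∑ x ∈ Finset.Icc 0 n, ∑ σ, v x σ * absorbAmp n 0 x σ = v 0 2 := by
      rw [Finset.sum_eq_single 0]
      · simp [absorbAmp]
      · intro x _ hx
        simp [absorbAmp, hx]
      · simp [hn]
    have h1 := (ih (forwardStep n v)).trans_eq (sum_sq_forwardStep n v)
    have h2 : (∑ x ∈ Finset.Icc 0 n, if 0 < x ∧ x < n then ∑ σ, v x σ ^ 2 else 0) + v 0 2 ^ 2 ≤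
        ∑ x ∈ Finset.Icc 0 n, ∑ σ, v x σ ^ 2 := by
      have h3 : v 0 2 ^ 2 = ∑ x ∈ Finset.Icc 0 n, if x = 0 then v 0 2 ^ 2 else 0 := by
        simp [hn]
      rw [h3, ← Finset.sum_add_distrib]
      refine Finset.sum_le_sum fun x _ => ?_
      by_cases hx : x = 0
      · subst hx
        simp only [lt_irrefl, false_and, if_false, if_true, zero_add]
        exact Finset.single_le_sum (f := fun σ => v 0 σ ^ 2) (fun σ _ => sq_nonneg _)
          (Finset.mem_univ 2)
      · rw [if_neg hx, add_zero]
        split_ifs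
        · exact le_rfl
        · positivity
    rw [h0]
    linarith

lemma summable_sq_absorbAmp (n x : ℤ) (hx : 0 ≤ x ∧ x ≤ n) (σ : Fin 3) :
    Summable fun t => absorbAmp n t x σ ^ 2 := by
  refine summable_of_sum_range_le (c := ∑ y ∈ Finset.Icc 0 n, ∑ σ' : Fin 3,
    (if y = x ∧ σ' = σ then (1 : ℝ) else 0) ^ 2) (fun t => sq_nonneg _) fun K => ?_
  refine le_trans (le_of_eq (Finset.sum_congr rfl fun t _ => ?_))
    (sum_sq_inner_absorbAmp_le n (hx.1.trans hx.2) K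
      fun y σ' => if y = x ∧ σ' = σ then (1 : ℝ) else 0)
  rw [Finset.sum_eq_single x, Finset.sum_eq_single σ]
  · simp
  · intro b _ hb
    simp [hb]
  · simp
  · intro b _ hb
    simp [hb]
  · simp [hx]

namespace LaurentSeries

/-- The variable of the field of real Laurent series. -/
noncomputable def zvar : LaurentSeries ℝ := HahnSeries.single 1 1

/-- The inverse of the variable of the field of real Laurent series. -/
noncomputable def zinv : LaurentSeries ℝ := HahnSeries.single (-1) 1

lemma zvar_mul_zinv : zvar * zinv = 1 := by
  simp [zvar, zinv, HahnSeries.single_mul_single]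

lemma coeff_zvar_mul (f : LaurentSeries ℝ) (i : ℤ) : (zvar * f).coeff i = f.coeff (i - 1) := by
  simp [zvar, HahnSeries.coeff_single_mul]

lemma coeff_zinv_mul (f : LaurentSeries ℝ) (i : ℤ) : (zinv * f).coeff i = f.coeff (i + 1) := by
  simp [zinv, HahnSeries.coeff_single_mul]

lemma coeff_const_mul (c : ℝ) (f : LaurentSeries ℝ) (i : ℤ) :
    (HahnSeries.C c * f).coeff i = c * f.coeff i := by
  simp [HahnSeries.C_apply]

lemma zvar_ne_zero : zvar ≠ 0 := left_ne_zero_of_mul_eq_one zvar_mul_zinv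

lemma zvar_sub_one_ne_zero : zvar - 1 ≠ 0 := by
  intro h
  simpa [zvar] using congrArg (fun f => HahnSeries.coeff f 1) h

lemma three_add_zvar_ne_zero : 3 + zvar ≠ 0 := by
  intro h
  have h3 : (3 : LaurentSeries ℝ) = HahnSeries.C 3 := (map_ofNat HahnSeries.C 3).symm
  rw [h3] at h
  simpa [zvar, HahnSeries.C_apply] using congrArg (fun f => HahnSeries.coeff f 1) h

/-- Square-summability of the coefficients of a Laurent series. -/
def SqSummable (f : LaurentSeries ℝ) : Prop := Summable fun i => f.coeff i ^ 2

/-- The `ℓ²` inner product of the coefficients of two Laurent series. -/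
noncomputable def coeffInner (f g : LaurentSeries ℝ) : ℝ := ∑' i, f.coeff i * g.coeff i

lemma coeffInner_comm (f g : LaurentSeries ℝ) : coeffInner f g = coeffInner g f := by
  simp only [coeffInner, mul_comm]

namespace SqSummable

variable {f g : LaurentSeries ℝ}

lemma summable_mul (hf : SqSummable f) (hg : SqSummable g) :
    Summable fun i => f.coeff i * g.coeff i := by
  refine Summable.of_norm_bounded (Summable.add hf hg) fun i => ?_
  rw [Real.norm_eq_abs, abs_le]
  constructor <;> nlinarith [sq_nonneg (f.coeff i + g.coeff i), sq_nonneg (f.coeff i - g.coeff i)]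

lemma add (hf : SqSummable f) (hg : SqSummable g) : SqSummable (f + g) := by
  refine (Summable.add (Summable.add hf hg) ((hf.summable_mul hg).mul_left 2)).congr fun i => ?_
  rw [HahnSeries.coeff_add]
  ring

lemma C_mul (c : ℝ) (hf : SqSummable f) : SqSummable (HahnSeries.C c * f) := by
  refine (Summable.mul_left (c ^ 2) hf).congr fun i => ?_
  rw [coeff_const_mul]
  ring

lemma zvar_mul (hf : SqSummable f) : SqSummable (zvar * f) := by
  simp only [SqSummable, coeff_zvar_mul]
  exact (Equiv.subRight (1 : ℤ)).summable_iff.mpr hf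

lemma zinv_mul (hf : SqSummable f) : SqSummable (zinv * f) := by
  simp only [SqSummable, coeff_zinv_mul]
  exact (Equiv.addRight (1 : ℤ)).summable_iff.mpr hf

end SqSummable

lemma coeffInner_add_right {f g h : LaurentSeries ℝ} (hf : SqSummable f) (hg : SqSummable g)
    (hh : SqSummable h) : coeffInner f (g + h) = coeffInner f g + coeffInner f h := by
  simp only [coeffInner, HahnSeries.coeff_add, mul_add]
  exact (hf.summable_mul hg).tsum_add (hf.summable_mul hh)

lemma coeffInner_C_mul_right (f g : LaurentSeries ℝ) (c : ℝ) :
    coeffInner f (HahnSeries.C c * g) = c * coeffInner f g := by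
  simp only [coeffInner, coeff_const_mul, ← tsum_mul_left]
  exact tsum_congr fun i => by ring

lemma coeffInner_sum_C_mul {ι : Type*} [Fintype ι] {w : LaurentSeries ℝ} (hw : SqSummable w)
    (c : ι → ℝ) (f : ι → LaurentSeries ℝ) (hf : ∀ i, SqSummable (f i)) :
    coeffInner w (∑ i, HahnSeries.C (c i) * f i) = ∑ i, c i * coeffInner w (f i) := by
  simp only [coeffInner, HahnSeries.coeff_sum, coeff_const_mul, Finset.mul_sum, ← tsum_mul_left]
  rw [← Summable.tsum_finsetSum fun i _ => (hw.summable_mul (hf i)).mul_left (c i)]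
  exact tsum_congr fun i => Finset.sum_congr rfl fun _ _ => by ring

/-- Multiplication by `P` and multiplication by `Q` preserve square-summability and are adjoint to
each other for `coeffInner`. -/
structure AdjointPair (P Q : LaurentSeries ℝ) : Prop where
  left {f : LaurentSeries ℝ} (hf : SqSummable f) : SqSummable (P * f)
  right {f : LaurentSeries ℝ} (hf : SqSummable f) : SqSummable (Q * f)
  inner_eq {f g : LaurentSeries ℝ} (hf : SqSummable f) (hg : SqSummable g) :
    coeffInner (P * f) g = coeffInner f (Q * g)

namespace AdjointPair

variable {P Q P' Q' : LaurentSeries ℝ}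

lemma symm (h : AdjointPair P Q) : AdjointPair Q P where
  left := h.right
  right := h.left
  inner_eq hf hg := by rw [coeffInner_comm, ← h.inner_eq hg hf, coeffInner_comm]

lemma add (h : AdjointPair P Q) (h' : AdjointPair P' Q') : AdjointPair (P + P') (Q + Q') where
  left hf := by rw [add_mul]; exact (h.left hf).add (h'.left hf)
  right hf := by rw [add_mul]; exact (h.right hf).add (h'.right hf)
  inner_eq {f g} hf hg := by
    rw [add_mul, add_mul, coeffInner_add_right hf (h.right hg) (h'.right hg), coeffInner_comm,
      coeffInner_add_right hg (h.left hf) (h'.left hf), ← h.inner_eq hf hg, ← h'.inner_eq hf hg,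
      coeffInner_comm g, coeffInner_comm g]

lemma mul (h : AdjointPair P Q) (h' : AdjointPair P' Q') : AdjointPair (P * P') (Q * Q') where
  left hf := by rw [mul_assoc]; exact h.left (h'.left hf)
  right hf := by rw [mul_assoc]; exact h.right (h'.right hf)
  inner_eq hf hg := by
    rw [mul_assoc, h.inner_eq (h'.left hf) hg, h'.inner_eq hf (h.right hg), mul_left_comm,
      mul_assoc]

lemma const (c : ℝ) : AdjointPair (HahnSeries.C c) (HahnSeries.C c) where
  left hf := hf.C_mul c
  right hf := hf.C_mul c
  inner_eq _ _ := by
    rw [coeffInner_C_mul_right, coeffInner_comm, coeffInner_C_mul_right, coeffInner_comm]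

lemma ofNat (k : ℕ) [k.AtLeastTwo] :
    AdjointPair (OfNat.ofNat k : LaurentSeries ℝ) (OfNat.ofNat k) := by
  simpa only [map_ofNat] using const (OfNat.ofNat k)

lemma one : AdjointPair 1 1 := by
  simpa only [map_one] using const 1

lemma neg (h : AdjointPair P Q) : AdjointPair (-P) (-Q) := by
  have h1 := (const (-1)).mul h
  rw [map_neg, map_one] at h1
  convert h1 using 1 <;> ring

lemma sub (h : AdjointPair P Q) (h' : AdjointPair P' Q') : AdjointPair (P - P') (Q - Q') := by
  simpa only [sub_eq_add_neg] using h.add h'.neg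

lemma zvar_zinv : AdjointPair zvar zinv where
  left hf := hf.zvar_mul
  right hf := hf.zinv_mul
  inner_eq {f g} _ _ := by
    simp only [coeffInner, coeff_zvar_mul, coeff_zinv_mul]
    rw [← (Equiv.addRight (1 : ℤ)).tsum_eq]
    simp

end AdjointPair

/-- The coefficients of `P` vanish in degrees larger than `d`. -/
def DegLE (d : ℤ) (P : LaurentSeries ℝ) : Prop := ∀ i, d < i → P.coeff i = 0

namespace DegLE

variable {d e : ℤ} {P Q : LaurentSeries ℝ}

lemma mono (h : DegLE d P) (hde : d ≤ e) : DegLE e P := fun i hi => h i (hde.trans_lt hi)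

lemma neg (h : DegLE d P) : DegLE d (-P) := fun i hi => by simp [h i hi]

lemma add (h : DegLE d P) (h' : DegLE d Q) : DegLE d (P + Q) := fun i hi => by
  simp [h i hi, h' i hi]

lemma sub (h : DegLE d P) (h' : DegLE d Q) : DegLE d (P - Q) := fun i hi => by
  simp [h i hi, h' i hi]

lemma mul (h : DegLE d P) (h' : DegLE e Q) : DegLE (d + e) (P * Q) := fun i hi => by
  rw [HahnSeries.coeff_mul]
  refine Finset.sum_eq_zero fun p hp => ?_
  have hp' : p.1 + p.2 = i := by simp at hp; exact hp.2.2
  by_cases h1 : d < p.1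
  · rw [h _ h1, zero_mul]
  · rw [h' _ (by omega), mul_zero]

lemma const (c : ℝ) : DegLE 0 (HahnSeries.C c) := fun i hi => by
  simp [HahnSeries.C_apply, HahnSeries.coeff_single_of_ne hi.ne']

lemma ofNat (k : ℕ) [k.AtLeastTwo] : DegLE 0 (OfNat.ofNat k : LaurentSeries ℝ) := by
  simpa only [map_ofNat] using const (OfNat.ofNat k)

lemma zvar : DegLE 1 zvar := fun _ hi => HahnSeries.coeff_single_of_ne hi.ne'

lemma zinv : DegLE (-1) zinv := fun _ hi => HahnSeries.coeff_single_of_ne hi.ne'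

end DegLE

/-- The trace of the one-site transfer matrix of the Grover walk. -/
noncomputable def groverTrace : LaurentSeries ℝ := -(4 + 3 * (zvar + zinv))

/-- Chebyshev polynomials of the second kind evaluated at the Grover trace. -/
noncomputable def chebS (k : ℤ) : LaurentSeries ℝ :=
  (Polynomial.Chebyshev.S (LaurentSeries ℝ) k).eval groverTrace

/-- Chebyshev polynomials of the first kind evaluated at the Grover trace. -/
noncomputable def chebC (k : ℤ) : LaurentSeries ℝ :=
  (Polynomial.Chebyshev.C (LaurentSeries ℝ) k).eval groverTrace

lemma chebS_add_one (k : ℤ) : chebS (k + 1) = groverTrace * chebS k - chebS (k - 1) := by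
  simp [chebS, Polynomial.Chebyshev.S_add_one]

lemma chebC_add_one (k : ℤ) : chebC (k + 1) = groverTrace * chebC k - chebC (k - 1) := by
  simp [chebC, Polynomial.Chebyshev.C_add_one]

lemma chebC_eq (k : ℤ) : chebC k = chebS k - chebS (k - 2) := by
  have h1 := Polynomial.Chebyshev.C_eq_S_sub_X_mul_S (LaurentSeries ℝ) k
  have h2 := Polynomial.Chebyshev.S_eq (LaurentSeries ℝ) k
  have h3 : Polynomial.Chebyshev.C (LaurentSeries ℝ) k = Polynomial.Chebyshev.S _ k -
    Polynomial.Chebyshev.S _ (k - 2) := by linear_combination h1 + h2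
  simp [chebC, chebS, h3]

lemma chebC_add (a j : ℤ) :
    chebC (a + j) = chebS a * chebC j - chebS (a - 1) * chebC (j - 1) := by
  induction a using Polynomial.Chebyshev.induct with
  | zero => simp [chebS]
  | one =>
    have := chebC_add_one j
    simp only [add_comm 1 j, this]
    simp [chebS]
  | add_two k h1 h2 =>
    have e1 := chebC_add_one (k + 1 + j)
    have e2 := chebS_add_one (k + 1)
    have e3 := chebS_add_one k
    rw [show (k : ℤ) + 1 + j + 1 = k + 2 + j by ring,
      show (k : ℤ) + 1 + j - 1 = k + j by ring] at e1
    rw [show (k : ℤ) + 1 + 1 = k + 2 by ring, show (k : ℤ) + 1 - 1 = k by ring] at e2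
    rw [show (k : ℤ) + 1 - 1 = k by ring] at h1
    rw [show (k : ℤ) + 2 - 1 = k + 1 by ring]
    linear_combination e1 + groverTrace * h1 - h2 - chebC j * e2 + chebC (j - 1) * e3
  | neg_add_one k h1 h2 =>
    have e1 := chebC_add_one (-k + j)
    have e2 := chebS_add_one (-k)
    have e3 := chebS_add_one (-k - 1)
    rw [show -(k : ℤ) + j + 1 = -k + 1 + j by ring,
      show -(k : ℤ) + j - 1 = -k - 1 + j by ring] at e1
    rw [show -(k : ℤ) - 1 + 1 = -k by ring] at e3
    rw [show -(k : ℤ) + 1 - 1 = -k by ring] at h2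
    linear_combination e1 + groverTrace * h1 - h2 - chebC j * e2 + chebC (j - 1) * e3

lemma adjointPair_groverTrace : AdjointPair groverTrace groverTrace := by
  have h := (AdjointPair.ofNat 4).add ((AdjointPair.ofNat 3).mul
    (AdjointPair.zvar_zinv.add AdjointPair.zvar_zinv.symm))
  rw [add_comm zinv] at h
  exact h.neg

lemma adjointPair_chebS (k : ℤ) : AdjointPair (chebS k) (chebS k) := by
  induction k using Polynomial.Chebyshev.induct with
  | zero => simpa [chebS] using AdjointPair.one
  | one => simpa [chebS] using adjointPair_groverTrace
  | add_two k h1 h2 =>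
    have e := chebS_add_one (k + 1)
    rw [show (k : ℤ) + 1 + 1 = k + 2 by ring, show (k : ℤ) + 1 - 1 = k by ring] at e
    rw [e]
    exact (adjointPair_groverTrace.mul h1).sub h2
  | neg_add_one k h1 h2 =>
    have e : chebS (-k - 1) = groverTrace * chebS (-k) - chebS (-k + 1) := by
      rw [chebS_add_one]
      ring
    rw [e]
    exact (adjointPair_groverTrace.mul h1).sub h2

lemma adjointPair_chebC (k : ℤ) : AdjointPair (chebC k) (chebC k) := by
  rw [chebC_eq]
  exact (adjointPair_chebS k).sub (adjointPair_chebS _)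

lemma degLE_groverTrace : DegLE 1 groverTrace :=
  (((DegLE.ofNat 4).mono zero_le_one).add
    ((DegLE.ofNat 3).mul (DegLE.zvar.add (DegLE.zinv.mono (by norm_num))))).neg

lemma degLE_chebC_natCast (k : ℕ) : DegLE k (chebC k) := by
  induction k using Nat.twoStepInduction with
  | zero => simpa [chebC] using DegLE.ofNat 2
  | one => simpa [chebC] using degLE_groverTrace
  | more k h1 h2 =>
    have e := chebC_add_one (k + 1)
    rw [show (k : ℤ) + 1 - 1 = k by ring] at e
    push_cast at h2 ⊢
    rw [show (k : ℤ) + 2 = k + 1 + 1 by ring, e]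
    exact ((degLE_groverTrace.mul h2).mono (by omega)).sub (h1.mono (by omega))

lemma degLE_chebC (k : ℤ) : DegLE |k| (chebC k) := by
  have h := degLE_chebC_natCast k.natAbs
  rwa [chebC, Polynomial.Chebyshev.C_natAbs, Int.natCast_natAbs] at h

lemma chebS_sq_sum (k : ℤ) :
    chebS (k - 3) ^ 2 - 134 * chebS (k - 2) ^ 2 + 3599 * chebS (k - 1) ^ 2 - 6932 * chebS k ^ 2 +
      3599 * chebS (k + 1) ^ 2 - 134 * chebS (k + 2) ^ 2 + chebS (k + 3) ^ 2 =
    (groverTrace ^ 2 - 36) * (groverTrace ^ 2 - 100) * chebC (2 * k + 2) := by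
  have e1 : chebC (2 * k + 2) = chebS k * chebC (k + 2) - chebS (k - 1) * chebC (k + 1) := by
    rw [show 2 * k + 2 = k + (k + 2) by ring, chebC_add, show k + 2 - 1 = k + 1 by ring]
  have e2 := chebC_eq (k + 2)
  have e3 := chebC_eq (k + 1)
  have s1 := chebS_add_one k
  have s2 := chebS_add_one (k + 1)
  have s3 := chebS_add_one (k + 2)
  have s4 := chebS_add_one (k - 1)
  have s5 := chebS_add_one (k - 2)
  rw [show k + 2 - 2 = k by ring] at e2
  rw [show k + 1 - 2 = k - 1 by ring] at e3
  rw [show k + 1 + 1 = k + 2 by ring, show k + 1 - 1 = k by ring] at s2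
  rw [show k + 2 + 1 = k + 3 by ring, show k + 2 - 1 = k + 1 by ring] at s3
  rw [show k - 1 + 1 = k by ring, show k - 1 - 1 = k - 2 by ring] at s4
  rw [show k - 2 + 1 = k - 1 by ring, show k - 2 - 1 = k - 3 by ring] at s5
  rw [e1, e2, e3, s3, s2, s1, eq_sub_of_add_eq' (eq_sub_iff_add_eq.mp s5),
    eq_sub_of_add_eq' (eq_sub_iff_add_eq.mp s4)]
  ring

/-- The denominator of the generating function of the absorption amplitudes. -/
noncomputable def groverDenom (N : ℤ) : LaurentSeries ℝ :=
  (3 + zvar) * chebS N - zvar * (zvar - 1) * chebS (N - 1)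

/-- `groverDenom N` with `zvar` replaced by its inverse. -/
noncomputable def groverDenomInv (N : ℤ) : LaurentSeries ℝ :=
  (3 + zinv) * chebS N - zinv * (zinv - 1) * chebS (N - 1)

/-- Cofactor of `groverDenom` in the numerator of the recurrence. -/
noncomputable def groverCofactor (j : ℤ) : LaurentSeries ℝ :=
  12 * (zinv - zvar) * (groverTrace - 6) * (groverTrace - 10) *
    (zinv * (zinv - 1) * chebC j - (3 + zinv) * chebC (j - 1))

/-- `groverCofactor j` with `zvar` replaced by its inverse. -/
noncomputable def groverCofactorInv (j : ℤ) : LaurentSeries ℝ :=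
  12 * (zvar - zinv) * (groverTrace - 6) * (groverTrace - 10) *
    (zvar * (zvar - 1) * chebC j - (3 + zvar) * chebC (j - 1))

lemma numerator_eq (N j : ℤ) :
    4 * (1 + zvar) * (1 + zinv) *
      ((groverTrace ^ 2 - 36) * (groverTrace ^ 2 - 100) * chebC (N + j)) =
    groverCofactor j * groverDenom N + groverCofactorInv j * groverDenomInv N := by
  rw [chebC_add, groverCofactor, groverCofactorInv, groverDenom, groverDenomInv, groverTrace,
    eq_inv_of_mul_eq_one_right zvar_mul_zinv]
  have := zvar_ne_zero
  field_simp
  ring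

lemma adjointPair_groverDenom (N : ℤ) : AdjointPair (groverDenom N) (groverDenomInv N) :=
  (((AdjointPair.ofNat 3).add AdjointPair.zvar_zinv).mul (adjointPair_chebS N)).sub
    ((AdjointPair.zvar_zinv.mul (AdjointPair.zvar_zinv.sub AdjointPair.one)).mul
      (adjointPair_chebS _))

lemma adjointPair_groverCofactor (j : ℤ) :
    AdjointPair (groverCofactor j) (groverCofactorInv j) :=
  ((((AdjointPair.ofNat 12).mul (AdjointPair.zvar_zinv.symm.sub AdjointPair.zvar_zinv)).mul
    (adjointPair_groverTrace.sub (AdjointPair.ofNat 6))).mul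
    (adjointPair_groverTrace.sub (AdjointPair.ofNat 10))).mul
    (((AdjointPair.zvar_zinv.symm.mul (AdjointPair.zvar_zinv.symm.sub AdjointPair.one)).mul
      (adjointPair_chebC j)).sub
    (((AdjointPair.ofNat 3).add AdjointPair.zvar_zinv.symm).mul (adjointPair_chebC _)))

lemma DegLE.one : DegLE 0 1 := by
  simpa only [map_one] using DegLE.const 1

lemma degLE_groverCofactor (j d : ℤ) (h1 : |j| ≤ d) (h2 : |j - 1| ≤ d - 1) :
    DegLE (d + 2) (groverCofactor j) := by
  have hz : DegLE 1 (zinv - zvar) := (DegLE.zinv.mono (by norm_num)).sub DegLE.zvar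
  have ht (k : ℕ) [k.AtLeastTwo] : DegLE 1 (groverTrace - OfNat.ofNat k) :=
    degLE_groverTrace.sub ((DegLE.ofNat k).mono zero_le_one)
  have hj : DegLE (d - 1) (zinv * (zinv - 1) * chebC j) :=
    ((DegLE.zinv.mul ((DegLE.zinv.mono (by norm_num)).sub DegLE.one)).mul
      ((degLE_chebC j).mono h1)).mono (by omega)
  have hj' : DegLE (d - 1) ((3 + zinv) * chebC (j - 1)) :=
    (((DegLE.ofNat 3).add (DegLE.zinv.mono (by norm_num))).mul
      ((degLE_chebC (j - 1)).mono h2)).mono (by omega)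
  exact (((((DegLE.ofNat 12).mul hz).mul (ht 6)).mul (ht 10)).mul (hj.sub hj')).mono (by omega)

lemma coeffInner_eq_zero {d : ℤ} {f g : LaurentSeries ℝ} (hf : ∀ i ≤ d, f.coeff i = 0)
    (hg : DegLE d g) : coeffInner f g = 0 := by
  refine (tsum_congr fun i => ?_).trans tsum_zero
  rcases le_or_gt i d with h | h
  · rw [hf i h, zero_mul]
  · rw [hg i h, mul_zero]

/-- The generating function of the absorption amplitudes from the state `R`, in terms of
the reciprocal `w` of `groverDenom`, with `k + 1` the distance to the right end point. -/
noncomputable def absorbSeries (w : LaurentSeries ℝ) (k : ℤ) : LaurentSeries ℝ :=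
  2 * zvar * (1 + zvar) * chebS k * w

lemma coeffInner_mul_numerator {w : LaurentSeries ℝ} (hw : SqSummable w) {N j d : ℤ}
    (hden : groverDenom N * w = 1) (hsupp : ∀ i ≤ d + 2, w.coeff i = 0)
    (h1 : |j| ≤ d) (h2 : |j - 1| ≤ d - 1) :
    coeffInner w (4 * (1 + zvar) * (1 + zinv) *
      ((groverTrace ^ 2 - 36) * (groverTrace ^ 2 - 100) * chebC (N + j)) * w) = 0 := by
  have hA := adjointPair_groverCofactor j
  have hD := adjointPair_groverDenom N
  have hAD := hA.mul hD
  have h0 : coeffInner w (groverCofactor j * groverDenom N * w) = 0 := by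
    rw [mul_assoc, hden, mul_one]
    exact coeffInner_eq_zero hsupp (degLE_groverCofactor j d h1 h2)
  rw [numerator_eq, add_mul, coeffInner_add_right hw (hAD.left hw) (hAD.right hw),
    ← hAD.inner_eq hw hw, coeffInner_comm _ w, h0, add_zero]

lemma coeffInner_absorbSeries {w : LaurentSeries ℝ} (hw : SqSummable w) (k : ℤ) :
    coeffInner (absorbSeries w k) (absorbSeries w k) =
      coeffInner w (4 * (1 + zvar) * (1 + zinv) * chebS k ^ 2 * w) := by
  have h := (((AdjointPair.ofNat 2).mul AdjointPair.zvar_zinv).mul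
    (AdjointPair.one.add AdjointPair.zvar_zinv)).mul (adjointPair_chebS k)
  rw [absorbSeries, h.inner_eq hw (h.left hw)]
  refine congrArg (coeffInner w) ?_
  linear_combination 4 * (1 + zvar) * (1 + zinv) * chebS k ^ 2 * w * zvar_mul_zinv

lemma absorbSeries_recurrence {w : LaurentSeries ℝ} (hw : SqSummable w) {N k : ℤ}
    (hden : groverDenom N * w = 1) (hsupp : ∀ i < N, w.coeff i = 0)
    (hk : 3 ≤ k) (hkN : k + 3 ≤ N) :
    let p := fun k => coeffInner (absorbSeries w k) (absorbSeries w k)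
    p (k - 3) - 134 * p (k - 2) + 3599 * p (k - 1) - 6932 * p k + 3599 * p (k + 1) -
      134 * p (k + 2) + p (k + 3) = 0 := by
  have hadj := (((AdjointPair.ofNat 4).mul (AdjointPair.one.add AdjointPair.zvar_zinv)).mul
    (AdjointPair.one.add AdjointPair.zvar_zinv.symm))
  have hF (i : Fin 7) : SqSummable
      (4 * (1 + zvar) * (1 + zinv) * chebS (k - 3 + (i : ℕ)) ^ 2 * w) := by
    rw [sq]
    exact (hadj.mul ((adjointPair_chebS _).mul (adjointPair_chebS _))).left hw
  have h := coeffInner_mul_numerator hw (N := N) (j := 2 * k + 2 - N) (d := N - 3) hden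
    (fun i hi => hsupp i (by omega)) (by rw [abs_le]; omega) (by rw [abs_le]; omega)
  rw [show N + (2 * k + 2 - N) = 2 * k + 2 by ring, ← chebS_sq_sum] at h
  simp only [coeffInner_absorbSeries hw]
  have hsum := coeffInner_sum_C_mul hw
    (![1, -134, 3599, -6932, 3599, -134, 1] : Fin 7 → ℝ)
    (fun i : Fin 7 => 4 * (1 + zvar) * (1 + zinv) * chebS (k - 3 + (i : ℕ)) ^ 2 * w) hF
  simp only [Fin.sum_univ_seven, Matrix.cons_val, map_neg, map_one, map_ofNat,
    Fin.coe_ofNat_eq_mod, Nat.reduceMod, Nat.cast_zero, Nat.cast_one, Nat.cast_ofNat,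
    add_zero, sub_add_cancel, show k - 3 + 1 = k - 2 by ring, show k - 3 + 2 = k - 1 by ring,
    show k - 3 + 4 = k + 1 by ring, show k - 3 + 5 = k + 2 by ring,
    show k - 3 + 6 = k + 3 by ring] at hsum
  refine Eq.trans ?_ (hsum.symm.trans (Eq.trans (congrArg (coeffInner w) ?_) h)) <;> ring

end LaurentSeries

open LaurentSeries

/-- The generating function of the absorption amplitudes from position `x` and state `σ`. -/
noncomputable def ampSeries (n x : ℤ) (σ : Fin 3) : LaurentSeries ℝ :=
  HahnSeries.ofPowerSeries ℤ ℝ (PowerSeries.mk fun t => absorbAmp n t x σ)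

lemma coeff_ampSeries_natCast (n x : ℤ) (σ : Fin 3) (t : ℕ) :
    (ampSeries n x σ).coeff t = absorbAmp n t x σ := by
  rw [ampSeries, coeff_coe_powerSeries, PowerSeries.coeff_mk]

lemma coeff_ampSeries_of_neg (n x : ℤ) (σ : Fin 3) {i : ℤ} (hi : i < 0) :
    (ampSeries n x σ).coeff i = 0 := by
  rw [ampSeries, PowerSeries.coeff_coe, if_pos hi]

lemma coeff_ampSeries_of_lt (n x : ℤ) (σ : Fin 3) {i : ℤ} (hi : i < x) :
    (ampSeries n x σ).coeff i = 0 := by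
  rcases lt_or_ge i 0 with h | h
  · exact coeff_ampSeries_of_neg n x σ h
  · lift i to ℕ using h
    rw [coeff_ampSeries_natCast, absorbAmp_eq_zero_of_lt n i x σ hi]

lemma ampSeries_eq {n x : ℤ} (hx : 0 < x ∧ x < n) (σ : Fin 3) :
    ampSeries n x σ =
      zvar * ∑ σ', HahnSeries.C (gamp σ σ') * ampSeries n (x + gstep σ') σ' := by
  ext i
  rw [coeff_zvar_mul, HahnSeries.coeff_sum]
  simp only [coeff_const_mul]
  rcases lt_or_ge i 1 with h | h
  · rw [coeff_ampSeries_of_lt _ _ _ (by omega)]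
    simp [coeff_ampSeries_of_neg _ _ _ (show i - 1 < 0 by omega)]
  · obtain ⟨t, rfl⟩ : ∃ t : ℕ, i = t + 1 := ⟨(i - 1).toNat, by omega⟩
    have := coeff_ampSeries_natCast n x σ (t + 1)
    push_cast at this
    simp only [this, add_sub_cancel_right, coeff_ampSeries_natCast, absorbAmp, if_pos hx]

lemma ampSeries_right_boundary (n : ℤ) (σ : Fin 3) (hn : 0 < n) : ampSeries n n σ = 0 := by
  have : (fun t => absorbAmp n t n σ) = fun _ => 0 := by
    funext t
    cases t <;> simp [absorbAmp, hn.ne']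
  rw [ampSeries, this]
  exact map_zero _

lemma ampSeries_left_boundary (n : ℤ) : ampSeries n 0 2 = 1 := by
  have : (PowerSeries.mk fun t => absorbAmp n t 0 2) = 1 := by
    ext t
    cases t <;> simp [absorbAmp, PowerSeries.coeff_one]
  rw [ampSeries, this, map_one]

lemma three_mul_ampSeries {n x : ℤ} (hx : 0 < x ∧ x < n) :
    3 * ampSeries n x 0 = zvar *
      (-ampSeries n (x + 1) 0 + 2 * ampSeries n x 1 + 2 * ampSeries n (x - 1) 2) ∧
    3 * ampSeries n x 1 = zvar *
      (2 * ampSeries n (x + 1) 0 - ampSeries n x 1 + 2 * ampSeries n (x - 1) 2) ∧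
    3 * ampSeries n x 2 = zvar *
      (2 * ampSeries n (x + 1) 0 + 2 * ampSeries n x 1 - ampSeries n (x - 1) 2) := by
  have h1 : (3 : LaurentSeries ℝ) * HahnSeries.C (-1 / 3) = -1 := by
    rw [← map_ofNat HahnSeries.C 3, ← map_mul, ← map_one HahnSeries.C, ← map_neg]
    norm_num
  have h2 : (3 : LaurentSeries ℝ) * HahnSeries.C (2 / 3) = 2 := by
    rw [← map_ofNat HahnSeries.C 3, ← map_mul, ← map_ofNat HahnSeries.C 2]
    norm_num
  have g0 : gstep 0 = 1 := by simp [gstep]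
  have g1 : gstep 1 = 0 := by simp [gstep]
  have g2 : gstep 2 = -1 := by simp [gstep]
  have e0 := ampSeries_eq hx 0
  have e1 := ampSeries_eq hx 1
  have e2 := ampSeries_eq hx 2
  simp only [Fin.sum_univ_three, gamp, g0, g1, g2, add_zero, ← sub_eq_add_neg, if_true,
    show ((0 : Fin 3) = 1) = False by simp, show ((0 : Fin 3) = 2) = False by simp,
    show ((1 : Fin 3) = 0) = False by simp, show ((1 : Fin 3) = 2) = False by simp,
    show ((2 : Fin 3) = 0) = False by simp, show ((2 : Fin 3) = 1) = False by simp,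
    if_false] at e0 e1 e2
  generalize ampSeries n (x + 1) 0 = a at *
  generalize ampSeries n (x - 1) 2 = l at *
  generalize ampSeries n x 0 = a' at *
  generalize ampSeries n x 1 = s at *
  generalize ampSeries n x 2 = l' at *
  refine ⟨?_, ?_, ?_⟩
  · linear_combination 3 * e0 + zvar * a * h1 + zvar * (s + l) * h2
  · linear_combination 3 * e1 + zvar * s * h1 + zvar * (a + l) * h2
  · linear_combination 3 * e2 + zvar * l * h1 + zvar * (a + s) * h2

lemma ampSeries_eq_chebS {n : ℤ} {w : LaurentSeries ℝ}
    (hw : 2 * zvar * w = ampSeries n (n - 1) 1) (k : ℕ) (hk : k + 2 ≤ n) :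
    ampSeries n (n - 1 - k) 0 = absorbSeries w k ∧
      ampSeries n (n - 2 - k) 2 = groverDenom k * w := by
  have hz := zvar_ne_zero
  have hz1 := zvar_sub_one_ne_zero
  have hz3 := three_add_zvar_ne_zero
  have h2 : (2 : LaurentSeries ℝ) ≠ 0 := by
    rw [← map_ofNat HahnSeries.C 2]
    exact (map_ne_zero _).2 two_ne_zero
  have h3 : (3 : LaurentSeries ℝ) ≠ 0 := by
    rw [← map_ofNat HahnSeries.C 3]
    exact (map_ne_zero _).2 three_ne_zero
  induction k with
  | zero =>
    obtain ⟨eA, eS, -⟩ := three_mul_ampSeries (n := n) (x := n - 1) (by omega)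
    rw [sub_add_cancel, ampSeries_right_boundary n 0 (by omega), ← hw,
      show n - 1 - 1 = n - 2 by ring] at eA eS
    simp only [Nat.cast_zero, sub_zero, absorbSeries, groverDenom, chebS, zero_sub,
      Polynomial.Chebyshev.S_zero, Polynomial.Chebyshev.S_neg_one, Polynomial.eval_one,
      Polynomial.eval_zero]
    have hl : ampSeries n (n - 2) 2 = (3 + zvar) * w := by
      refine mul_left_cancel₀ (mul_ne_zero h2 hz) ?_
      linear_combination -eS
    refine ⟨mul_left_cancel₀ h3 ?_, by rw [hl]; ring⟩
    linear_combination eA + 2 * zvar * hl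
  | succ k ih =>
    push_cast at hk
    obtain ⟨ha, hl⟩ := ih (by omega)
    obtain ⟨eA, eS, eL⟩ := three_mul_ampSeries (n := n) (x := n - 2 - k) (by omega)
    have hU := chebS_add_one k
    have hτ : zvar * groverTrace = -(3 * zvar ^ 2 + 4 * zvar + 3) := by
      rw [groverTrace]
      linear_combination -3 * zvar_mul_zinv
    push_cast
    rw [show n - 2 - (k : ℤ) + 1 = n - 1 - k by ring, ha,
      show n - 2 - (k : ℤ) - 1 = n - 2 - (k + 1) by ring] at eA eS eL
    rw [hl] at eL
    rw [show n - 1 - ((k : ℤ) + 1) = n - 2 - k by ring]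
    simp only [groverDenom, absorbSeries, add_sub_cancel_right] at *
    generalize ampSeries n (n - 2 - (k + 1)) 2 = l at *
    generalize ampSeries n (n - 2 - k) 0 = a at *
    generalize ampSeries n (n - 2 - k) 1 = s at *
    have hl' : l = ((3 + zvar) * chebS (k + 1) - zvar * (zvar - 1) * chebS k) * w := by
      refine mul_left_cancel₀ (mul_ne_zero (mul_ne_zero h3 hz) hz1) ?_
      linear_combination -(3 + zvar) * eL - 2 * zvar * eS -
        3 * zvar * (zvar - 1) * (3 + zvar) * w * hU -
        3 * (zvar - 1) * (3 + zvar) * w * chebS k * hτ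
    refine ⟨mul_left_cancel₀ (mul_ne_zero h3 hz3) ?_, hl'⟩
    linear_combination (3 + zvar) * eA + 2 * zvar * eS + 6 * zvar * (1 + zvar) * hl'

lemma support_coeff_ampSeries_subset (n x : ℤ) (σ : Fin 3) :
    Function.support (fun i => (ampSeries n x σ).coeff i ^ 2) ⊆ Set.range ((↑) : ℕ → ℤ) := by
  intro i hi
  by_contra h
  refine hi ?_
  have hneg : i < 0 := by
    by_contra h0
    exact h ⟨i.toNat, by omega⟩
  simp [coeff_ampSeries_of_neg n x σ hneg]

lemma sqSummable_ampSeries {n x : ℤ} (hx : 0 ≤ x ∧ x ≤ n) (σ : Fin 3) :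
    SqSummable (ampSeries n x σ) := by
  refine (Function.Injective.summable_iff (Nat.cast_injective (R := ℤ)) fun i hi => ?_).1 ?_
  · by_contra h
    exact hi (support_coeff_ampSeries_subset n x σ h)
  · exact (summable_sq_absorbAmp n x hx σ).congr fun t => by
      simp [coeff_ampSeries_natCast]

lemma GPfin_eq_coeffInner (n m : ℕ) :
    GPfin n m = coeffInner (ampSeries n m 0) (ampSeries n m 0) := by
  simp only [coeffInner, ← sq]
  rw [← Function.Injective.tsum_eq (Nat.cast_injective (R := ℤ))
    (support_coeff_ampSeries_subset n m 0)]
  simp only [GPfin, gcFin_eq_absorbAmp, coeff_ampSeries_natCast]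

theorem finite_absorption_grover_sixth_order_recurrence (m n : ℕ)
    (hm : 1 ≤ m) (hmn : m + 6 ≤ n - 1) :
    GPfin n (m + 6) - 134 * GPfin n (m + 5) + 3599 * GPfin n (m + 4) -
      6932 * GPfin n (m + 3) + 3599 * GPfin n (m + 2) - 134 * GPfin n (m + 1) +
      GPfin n m = 0 := by
  set w : LaurentSeries ℝ := zinv * (HahnSeries.C (1 / 2) * ampSeries n (n - 1) 1) with hw
  have hw2 : 2 * zvar * w = ampSeries n (n - 1) 1 := by
    have h2 : (2 : LaurentSeries ℝ) * HahnSeries.C (1 / 2) = 1 := by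
      rw [← map_ofNat HahnSeries.C 2, ← map_mul, ← map_one HahnSeries.C]
      norm_num
    rw [hw]
    linear_combination 2 * HahnSeries.C (1 / 2) * ampSeries n (n - 1) 1 * zvar_mul_zinv +
      ampSeries n (n - 1) 1 * h2
  have hws : SqSummable w := ((sqSummable_ampSeries (by omega) 1).C_mul _).zinv_mul
  have hden : groverDenom (n - 2) * w = 1 := by
    have h := (ampSeries_eq_chebS hw2 (n - 2) (by omega)).2
    rw [show ((n - 2 : ℕ) : ℤ) = n - 2 by omega, sub_self, ampSeries_left_boundary] at h
    exact h.symm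
  have hsupp : ∀ i < (n : ℤ) - 2, w.coeff i = 0 := fun i hi => by
    rw [hw, coeff_zinv_mul, coeff_const_mul, coeff_ampSeries_of_lt _ _ _ (by omega), mul_zero]
  have hGP (j : ℕ) (k : ℤ) (hk : k = n - 1 - j) (hj : 1 ≤ j ∧ j + 1 ≤ n) :
      GPfin n j = coeffInner (absorbSeries w k) (absorbSeries w k) := by
    have h := (ampSeries_eq_chebS hw2 (n - 1 - j) (by omega)).1
    rw [show ((n - 1 - j : ℕ) : ℤ) = k by omega, show (n : ℤ) - 1 - k = j by omega] at h
    rw [GPfin_eq_coeffInner, h]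
  have h := absorbSeries_recurrence hws hden hsupp (k := n - 4 - m) (by omega) (by omega)
  rw [hGP (m + 6) (n - 4 - m - 3) (by omega) (by omega),
    hGP (m + 5) (n - 4 - m - 2) (by omega) (by omega),
    hGP (m + 4) (n - 4 - m - 1) (by omega) (by omega),
    hGP (m + 3) (n - 4 - m) (by omega) (by omega),
    hGP (m + 2) (n - 4 - m + 1) (by omega) (by omega),
    hGP (m + 1) (n - 4 - m + 2) (by omega) (by omega),
    hGP m (n - 4 - m + 3) (by omega) (by omega)]
  exact h
end

section
/- Let a, b, c, d ∈ ℂ and let (f_n)_{n≥1} be a sequence of complex numbers with f_1 = 0 and, for every k ≥ 1, c·f_k + d ≠ 0 and f_{k+1} = (a·f_k + b)/(c·f_k + d). Let λ_+, λ_− ∈ ℂ be the two roots of λ² − (a + d)λ + (ad − bc) = 0, and set R_k = λ_+^k − λ_−^k. Then for every n ≥ 1 with R_n − a·R_{n−1} ≠ 0, one has f_n = b·R_{n−1}/(R_n − a·R_{n−1}). -/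
theorem linear_fractional_recurrence_closed_form (a b c d lamP lamM : ℂ)
    (hsum : lamP + lamM = a + d) (hprod : lamP * lamM = a * d - b * c)
    (f : ℕ → ℂ) (hf1 : f 1 = 0)
    (hden : ∀ k : ℕ, 1 ≤ k → c * f k + d ≠ 0)
    (hrec : ∀ k : ℕ, 1 ≤ k → f (k + 1) = (a * f k + b) / (c * f k + d)) :
    ∀ n : ℕ, 1 ≤ n →
      (lamP ^ n - lamM ^ n) - a * (lamP ^ (n - 1) - lamM ^ (n - 1)) ≠ 0 →
      f n = b * (lamP ^ (n - 1) - lamM ^ (n - 1)) /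
        ((lamP ^ n - lamM ^ n) - a * (lamP ^ (n - 1) - lamM ^ (n - 1))) := by
  have cross : ∀ m : ℕ, f (m + 1) *
      ((lamP ^ (m + 1) - lamM ^ (m + 1)) - a * (lamP ^ m - lamM ^ m)) =
        b * (lamP ^ m - lamM ^ m) := by
    intro m
    induction m with
    | zero => simp [hf1]
    | succ m ih =>
      have hd := hden (m + 1) (by omega)
      have hP : lamP ^ (m + 1 + 1) = (a + d) * lamP ^ (m + 1) - (a * d - b * c) * lamP ^ m := by
        rw [← hsum, ← hprod]; ring
      have hM : lamM ^ (m + 1 + 1) = (a + d) * lamM ^ (m + 1) - (a * d - b * c) * lamM ^ m := by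
        rw [← hsum, ← hprod]; ring
      rw [hrec (m + 1) (by omega), div_mul_eq_mul_div, div_eq_iff hd, hP, hM]
      generalize lamP ^ (m + 1) = P1 at *
      generalize lamM ^ (m + 1) = M1 at *
      generalize lamP ^ m = P0 at *
      generalize lamM ^ m = M0 at *
      linear_combination (a * d - b * c) * ih
  intro n hn hne
  obtain ⟨m, rfl⟩ : ∃ m, n = m + 1 := ⟨n - 1, by omega⟩
  rw [Nat.add_sub_cancel] at hne ⊢
  exact (eq_div_iff hne).2 (cross m)
end
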